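/- Let m, d, e, k satisfy e = gcd(m,d) = gcd(m,2d) and 2 ≤ k ≤ (m+e)/(2e). Define β_r = 2^{-m}·#{a⃗ ∈ F_{2^m}^k : rk(B_{a⃗}) = r, (a_1,...,a_{k-1}) ≠ 0}, where B_{a⃗}(x,y) = Σ_{j=1}^{k-1} Tr_{F_{2^m}/F_{2^e}}(a_j(x y^{2^{jd}} + x^{2^{jd}} y)). Then for 0 ≤ i ≤ k-2, β_{(m-e)/e - 2i} = Σ_{j=i}^{k-2} (-1)^{j-i} 2^{e(j-i)(j-i-1)} (j choose i)_{4^e} ((m-e)/(2e) choose j)_{4^e} (2^{m(k-1-j)} - 1). -/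

import Mathlib

open Finset
open scoped Classical

/-- The Gaussian (q-)binomial coefficient, defined via the q-Pascal recurrence. -/
def gaussBinom {R : Type*} [CommRing R] (q : R) : ℕ → ℕ → R
  | _, 0 => 1
  | 0, _ + 1 => 0
  | u + 1, i + 1 => gaussBinom q u i + q ^ (i + 1) * gaussBinom q u (i + 1)

/-- A nonzero polynomial of degree at most `D` in an automorphism `σ` with fixed field `F`
has kernel of dimension at most `D`. -/
theorem coeff_eq_zero_of_lt_finrank {F K : Type*} [Field F] [Field K] [Algebra F K]
    [FiniteDimensional F K] (σ : K ≃ₐ[F] K)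
    (hfix : ∀ z, σ z = z → z ∈ (algebraMap F K).range) (D : ℕ) :
    ∀ (w : ℕ → K) (W : Submodule F K),
      (∀ z ∈ W, ∑ b ∈ range (D + 1), w b * (σ ^ b) z = 0) →
      D < Module.finrank F W → ∀ b ≤ D, w b = 0 := by
  induction D with
  | zero =>
    intro w W hW hD b hb
    obtain ⟨z, hz, hz0⟩ := Submodule.exists_mem_ne_zero_of_ne_bot
      (Submodule.one_le_finrank_iff.mp hD)
    have := hW z hz
    obtain rfl : b = 0 := by omega
    simpa [hz0] using this
  | succ D ih =>
    intro w W hW hD b hb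
    obtain ⟨z₀, hz, hz0⟩ := Submodule.exists_mem_ne_zero_of_ne_bot
      (Submodule.one_le_finrank_iff.mp (by omega : 1 ≤ Module.finrank F W))
    set w' : ℕ → K := fun c => w c * (σ ^ c) z₀ with hw'
    set S : ℕ → K := fun b => ∑ c ∈ range (b + 1), w' c with hS
    have hSD : S (D + 1) = 0 := hW z₀ hz
    have parts : ∀ (N : ℕ) (s : ℕ → K), ∑ b ∈ range (N + 1), w' b * s b =
        ∑ b ∈ range N, S b * (s b - s (b + 1)) + S N * s N := by
      intro N s
      induction N with
      | zero => simp [hS]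
      | succ N ihN =>
        rw [sum_range_succ, ihN, sum_range_succ _ N]
        have : S (N + 1) = S N + w' (N + 1) := by simp only [hS]; rw [sum_range_succ]
        rw [this]; ring
    let f : K →ₗ[F] K := (LinearMap.id - (σ : K →ₐ[F] K).toLinearMap) ∘ₗ LinearMap.mulLeft F z₀⁻¹
    have hf : ∀ z, f z = z₀⁻¹ * z - σ (z₀⁻¹ * z) := fun z => by simp [f]
    have hker : Module.finrank F (LinearMap.ker (f.domRestrict W)) ≤ 1 := by
      refine finrank_le_one ⟨⟨z₀, hz⟩, ?_⟩ ?_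
      · simp [hf, hz0]
      · rintro ⟨⟨z, hzW⟩, hzk⟩
        have : f z = 0 := by simpa using hzk
        rw [hf, sub_eq_zero] at this
        obtain ⟨c, hc⟩ := hfix _ this.symm
        refine ⟨c, ?_⟩
        apply Subtype.ext; apply Subtype.ext
        change c • z₀ = z
        rw [Algebra.smul_def, hc]; field_simp
    have hrange := LinearMap.finrank_range_add_finrank_ker (f.domRestrict W)
    have key := ih S (LinearMap.range (f.domRestrict W)) (by
      rintro _ ⟨⟨z, hzW⟩, rfl⟩
      have h1 := parts (D + 1) (fun b => (σ ^ b) (z₀⁻¹ * z))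
      rw [hSD, zero_mul, add_zero] at h1
      have h2 : ∑ b ∈ range (D + 1 + 1), w' b * (σ ^ b) (z₀⁻¹ * z) = 0 := by
        rw [← hW z hzW]
        refine sum_congr rfl fun b _ => ?_
        have : (σ ^ b) z₀ ≠ 0 := (map_ne_zero _).mpr hz0
        simp only [hw', map_mul, map_inv₀]
        field_simp
      rw [h2] at h1
      rw [h1]
      refine sum_congr rfl fun b _ => ?_
      simp only [LinearMap.domRestrict_apply, hf, map_sub]
      rw [pow_succ, AlgEquiv.mul_apply]) (by omega)
    have hS0 : ∀ b ≤ D + 1, S b = 0 := by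
      intro b hb
      rcases Nat.lt_or_ge b (D + 1) with h | h
      · exact key b (by omega)
      · rw [show b = D + 1 by omega, hSD]
    have hw0 : w' b = 0 := by
      cases b with
      | zero => simpa [hS] using hS0 0 hb
      | succ b =>
        have h1 := hS0 (b + 1) hb
        have h2 := hS0 b (by omega)
        simp only [hS] at h1 h2
        rwa [sum_range_succ, h2, zero_add] at h1
    have : (σ ^ b) z₀ ≠ 0 := (map_ne_zero _).mpr hz0
    exact (mul_eq_zero.mp hw0).resolve_right this

/-- The rank of an alternating bilinear form is even. -/
theorem even_finrank_add_finrank_radical {F V : Type*} [Field F] [AddCommGroup V] [Module F V]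
    [FiniteDimensional F V] (B : LinearMap.BilinForm F V) (hB : B.IsAlt) :
    Even (Module.finrank F V + Module.finrank F (LinearMap.ker B)) := by
  rw [← LinearMap.BilinForm.orthogonal_top_eq_ker hB.isRefl]
  obtain ⟨L, hL⟩ := exists_maximal_of_wellFoundedGT (fun L : Submodule F V => L ≤ B.orthogonal L)
    ⟨⊥, bot_le⟩
  have hLL : B.orthogonal L = L := by
    refine le_antisymm (fun v hv => ?_) hL.prop
    have hv' : ∀ l ∈ L, B l v = 0 := hv
    have : (L ⊔ F ∙ v) ≤ B.orthogonal (L ⊔ F ∙ v) := by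
      refine sup_le (fun x hx y hy => ?_) ?_
      · obtain ⟨l, hl, z, hz, rfl⟩ := Submodule.mem_sup.mp hy
        obtain ⟨c, rfl⟩ := Submodule.mem_span_singleton.mp hz
        have h1 : B l x = 0 := hL.prop hx l hl
        have h2 : B v x = 0 := hB.eq_iff.mp (hv' x hx)
        change B (l + c • v) x = 0
        simp [h1, h2]
      · rw [Submodule.span_singleton_le_iff_mem]
        intro y hy
        obtain ⟨l, hl, z, hz, rfl⟩ := Submodule.mem_sup.mp hy
        obtain ⟨c, rfl⟩ := Submodule.mem_span_singleton.mp hz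
        change B (l + c • v) v = 0
        simp [hv' l hl, hB.self_eq_zero v]
    exact hL.le_of_ge this le_sup_left (Submodule.mem_sup_right (Submodule.mem_span_singleton_self v))
  have h := LinearMap.BilinForm.finrank_add_finrank_orthogonal hB.isRefl L
  have hle : B.orthogonal ⊤ ≤ L := hLL ▸ LinearMap.BilinForm.orthogonal_le le_top
  rw [hLL, inf_eq_right.mpr hle] at h
  exact ⟨_, h.symm⟩

section Cyclic

variable {F K : Type*} [Field F] [Field K] [Algebra F K] [FiniteDimensional F K] [IsGalois F K]
  {σ : K ≃ₐ[F] K} (hσ : orderOf σ = Module.finrank F K)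
include hσ

theorem zpowers_eq_top_of_orderOf_eq_finrank : Subgroup.zpowers σ = ⊤ := by
  apply Subgroup.eq_top_of_card_eq
  rw [Nat.card_zpowers, hσ, IsGalois.card_aut_eq_finrank]

theorem mem_range_algebraMap_of_fixed (z : K) (hz : σ z = z) : z ∈ (algebraMap F K).range := by
  refine (IsGalois.mem_range_algebraMap_iff_fixed z).mpr fun g => ?_
  have hle : Subgroup.zpowers σ ≤ MulAction.stabilizer (K ≃ₐ[F] K) z := by
    rw [Subgroup.zpowers_le]
    exact hz
  rw [zpowers_eq_top_of_orderOf_eq_finrank hσ] at hle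
  exact hle (Subgroup.mem_top g)

theorem algebraMap_trace_eq_sum_iterate (z : K) :
    algebraMap F K (Algebra.trace F K z) = ∑ b ∈ range (Module.finrank F K), (σ ^ b) z := by
  have hinj : Set.InjOn (fun b => σ ^ b) (range (Module.finrank F K) : Set ℕ) := by
    intro a ha b hb h
    have ha : a < orderOf σ := by simpa [hσ] using ha
    have hb : b < orderOf σ := by simpa [hσ] using hb
    exact pow_injOn_Iio_orderOf ha hb h
  rw [trace_eq_sum_automorphisms, ← sum_image (f := fun g : K ≃ₐ[F] K => g z) hinj]
  congr 1
  symm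
  apply eq_univ_of_card
  rw [card_image_of_injOn hinj, card_range, ← Nat.card_eq_fintype_card,
    IsGalois.card_aut_eq_finrank]

end Cyclic

section Gold

variable {F K : Type*} [Field F] [Field K] [Algebra F K]

/-- The vector whose `j`-th entry is `x σ^j(y) + σ^j(x) y`, as a bilinear function of `x`, `y`. -/
def goldPairing (σ : K ≃ₐ[F] K) (k : ℕ) : K →ₗ[F] K →ₗ[F] (Fin k → K) :=
  LinearMap.mk₂ F (fun x y j => x * (σ ^ (j : ℕ)) y + (σ ^ (j : ℕ)) x * y)
    (fun x x' y => by ext j; simp only [map_add, Pi.add_apply]; ring)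
    (fun c x y => by ext j; simp only [map_smul, Pi.smul_apply, smul_add, smul_mul_assoc])
    (fun x y y' => by ext j; simp only [map_add, Pi.add_apply]; ring)
    (fun c x y => by ext j; simp only [map_smul, Pi.smul_apply, smul_add, mul_smul_comm])

theorem goldPairing_apply (σ : K ≃ₐ[F] K) (k : ℕ) (x y : K) (j : Fin k) :
    goldPairing σ k x y j = x * (σ ^ (j : ℕ)) y + (σ ^ (j : ℕ)) x * y := rfl

/-- The trace form on `K^k`. -/
noncomputable def traceFormPi (F K : Type*) [Field F] [Field K] [Algebra F K] (k : ℕ) :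
    LinearMap.BilinForm F (Fin k → K) :=
  LinearMap.mk₂ F (fun a b => ∑ j, Algebra.trace F K (a j * b j))
    (fun a a' b => by simp [add_mul, sum_add_distrib])
    (fun c a b => by simp [mul_sum])
    (fun a b b' => by simp [mul_add, sum_add_distrib])
    (fun c a b => by simp [mul_sum])

theorem traceFormPi_apply (k : ℕ) (a b : Fin k → K) :
    traceFormPi F K k a b = ∑ j, Algebra.trace F K (a j * b j) := rfl

/-- The Gold type bilinear form `∑ j, Tr (a_j (x σ^j(y) + σ^j(x) y))`. -/
noncomputable def goldForm (σ : K ≃ₐ[F] K) {k : ℕ} (a : Fin k → K) : LinearMap.BilinForm F K :=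
  (goldPairing σ k).compr₂ (traceFormPi F K k a)

theorem goldForm_apply (σ : K ≃ₐ[F] K) {k : ℕ} (a : Fin k → K) (x y : K) :
    goldForm σ a x y = traceFormPi F K k a (goldPairing σ k x y) := rfl

theorem goldForm_isAlt [CharP K 2] (σ : K ≃ₐ[F] K) {k : ℕ} (a : Fin k → K) :
    (goldForm σ a).IsAlt := by
  intro x
  rw [goldForm_apply, traceFormPi_apply]
  refine sum_eq_zero fun j _ => ?_
  rw [goldPairing_apply, mul_comm x, CharTwo.add_self_eq_zero, mul_zero, map_zero]

theorem trace_pow_apply (σ : K ≃ₐ[F] K) (b : ℕ) (x : K) :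
    Algebra.trace F K ((σ ^ b) x) = Algebra.trace F K x := Algebra.trace_eq_of_algEquiv _ _

variable [FiniteDimensional F K] [IsGalois F K]

theorem eq_zero_of_trace_mul_eq_zero {x : K} (h : ∀ y, Algebra.trace F K (x * y) = 0) : x = 0 :=
  (traceForm_nondegenerate F K).1 x h

theorem traceFormPi_nondegenerate (k : ℕ) : (traceFormPi F K k).Nondegenerate := by
  have key : ∀ a : Fin k → K, (∀ b, traceFormPi F K k a b = 0) → a = 0 := by
    intro a ha
    ext j
    refine eq_zero_of_trace_mul_eq_zero (F := F) fun y => ?_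
    have := ha (Pi.single j y)
    rw [traceFormPi_apply, sum_eq_single j] at this
    · simpa using this
    · intro i _ hij
      simp [hij]
    · simp
  refine ⟨key, fun a ha => key a fun b => ?_⟩
  rw [← ha b, traceFormPi_apply, traceFormPi_apply]
  exact sum_congr rfl fun j _ => by rw [mul_comm]

theorem finrank_ker_goldForm_le [CharP K 2] {σ : K ≃ₐ[F] K} (hσ : orderOf σ = Module.finrank F K) (s : ℕ)
    (a : Fin (s + 1) → K) (ha : ∃ j : Fin (s + 1), (j : ℕ) ≠ 0 ∧ a j ≠ 0) :
    Module.finrank F (LinearMap.ker (goldForm σ a)) ≤ 2 * s := by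
  by_contra! hlt
  obtain ⟨j₀, hj₀, hne⟩ := ha
  set a' : ℕ → K := fun j => if h : j < s + 1 then a ⟨j, h⟩ else 0 with ha'
  have haa : ∀ j : Fin (s + 1), a j = a' j := fun j => by
    simp only [ha', dif_pos j.isLt]
  set w : ℕ → K := fun b => if b < s then (σ ^ b) (a' (s - b)) else
    if b = s then 0 else (σ ^ s) (a' (b - s)) with hw
  have hP : ∀ x, ∑ b ∈ range (2 * s + 1), w b * (σ ^ b) x = ∑ j ∈ range s,
      ((σ ^ (s - (j + 1))) (a' (j + 1) * x) + (σ ^ s) (a' (j + 1) * (σ ^ (j + 1)) x)) := by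
    intro x
    rw [show 2 * s + 1 = s + (1 + s) by ring, sum_range_add, sum_range_add, sum_add_distrib]
    simp only [sum_range_one]
    rw [← sum_range_reflect (fun b => w b * (σ ^ b) x)]
    have h0 : w (s + 0) = 0 := by simp [hw]
    rw [h0, zero_mul, zero_add]
    congr 1 <;> refine sum_congr rfl fun j hj => ?_
    · have hj := mem_range.mp hj
      have h1 : s - 1 - j < s := by omega
      have h2 : s - (s - 1 - j) = j + 1 := by omega
      simp only [hw, if_pos h1, h2, map_mul]
      rw [show s - 1 - j = s - (j + 1) by omega]
    · have h1 : ¬ s + (1 + j) < s := by omega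
      have h2 : ¬ s + (1 + j) = s := by omega
      have h3 : s + (1 + j) - s = j + 1 := by omega
      simp only [hw, if_neg h1, if_neg h2, h3, map_mul]
      rw [add_comm 1 j, pow_add σ s, AlgEquiv.mul_apply]
  have hw0 := coeff_eq_zero_of_lt_finrank σ (mem_range_algebraMap_of_fixed hσ) (2 * s) w
    (LinearMap.ker (goldForm σ a)) (fun x hx => by
      refine eq_zero_of_trace_mul_eq_zero (F := F) fun y' => ?_
      obtain ⟨y, rfl⟩ := (σ ^ s).surjective y'
      have hxy : goldForm σ a x y = 0 := by rw [LinearMap.mem_ker.mp hx]; rfl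
      rw [← hxy, goldForm_apply, traceFormPi_apply, hP, sum_mul, map_sum]
      simp only [goldPairing_apply, haa]
      rw [Fin.sum_univ_eq_sum_range (fun j => Algebra.trace F K
        (a' j * (x * (σ ^ j) y + (σ ^ j) x * y))), sum_range_succ']
      have hz : Algebra.trace F K (a' 0 * (x * (σ ^ 0) y + (σ ^ 0) x * y)) = 0 := by
        simp [CharTwo.add_self_eq_zero]
      rw [hz, add_zero]
      refine sum_congr rfl fun j hj => ?_
      have hj := mem_range.mp hj
      have hs : (σ ^ s) y = (σ ^ (s - (j + 1))) ((σ ^ (j + 1)) y) := by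
        rw [← AlgEquiv.mul_apply, ← pow_add, Nat.sub_add_cancel hj]
      rw [add_mul, map_add, ← map_mul (σ ^ s), trace_pow_apply, hs, ← map_mul, trace_pow_apply,
        ← map_add]
      congr 1; ring) hlt
  have h1 := hw0 (s + j₀) (by omega)
  have h2 : ¬ s + (j₀ : ℕ) < s := by omega
  have h3 : ¬ s + (j₀ : ℕ) = s := by omega
  have h4 : s + (j₀ : ℕ) - s = j₀ := by omega
  simp only [hw, if_neg h2, if_neg h3, h4, ← haa] at h1
  exact hne ((map_eq_zero _).mp h1)

theorem exists_dual_family {u : ℕ} {x : Fin u → K} (hx : LinearIndependent F x) :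
    ∃ z : Fin u → K, ∀ i l, Algebra.trace F K (x i * z l) = if i = l then 1 else 0 := by
  obtain ⟨g, hg⟩ := LinearMap.exists_extend hx.repr
  have hgx : ∀ i, g (x i) = Finsupp.single i 1 := fun i => by
    rw [← hx.repr_eq_single i ⟨x i, Submodule.subset_span ⟨i, rfl⟩⟩ rfl, ← hg]; rfl
  let φ : Fin u → Module.Dual F K := fun l => Finsupp.lapply l ∘ₗ g
  refine ⟨fun l => ((Algebra.traceForm F K).toDual (traceForm_nondegenerate F K)).symm (φ l), 
    fun i l => ?_⟩
  have := LinearMap.BilinForm.apply_toDual_symm_apply (hB := traceForm_nondegenerate F K) (φ l) (x i)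
  rw [Algebra.traceForm_apply, mul_comm] at this
  rw [this]
  simp [φ, hgx, Finsupp.single_apply]

theorem trace_relation_of_sum_goldPairing_eq_zero [CharP K 2] {σ : K ≃ₐ[F] K}
    (hσ : orderOf σ = Module.finrank F K) {s u : ℕ} (hu : u ≤ s) (hs : 2 * s < Module.finrank F K)
    (x y : Fin u → K) (hxy : ∑ i, goldPairing σ (s + 1) (x i) (y i) = 0) (z : K) :
    ∑ i, (Algebra.trace F K (y i * z) • x i + Algebra.trace F K (x i * z) • y i) = 0 := by
  set n := Module.finrank F K with hn
  set w : ℕ → K := fun b => ∑ i, (x i * (σ ^ b) (y i) + (σ ^ b) (x i) * y i) with hw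
  have hL : ∀ z, ∑ i, (Algebra.trace F K (y i * z) • x i + Algebra.trace F K (x i * z) • y i) =
      ∑ b ∈ range n, w b * (σ ^ b) z := by
    intro z
    simp only [hw, Algebra.smul_def, algebraMap_trace_eq_sum_iterate hσ, sum_mul]
    rw [sum_comm]
    refine sum_congr rfl fun i _ => ?_
    rw [← sum_add_distrib]
    refine sum_congr rfl fun b _ => ?_
    rw [map_mul, map_mul]; ring
  have hlow : ∀ b ≤ s, w b = 0 := by
    intro b hb
    have := congrFun hxy ⟨b, by omega⟩
    rw [Finset.sum_apply] at this
    exact this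
  have hhigh : ∀ b < n, n - s ≤ b → w b = 0 := by
    intro b hb hb'
    have h1 : (σ ^ (n - b)) (w b) = w (n - b) := by
      simp only [hw, map_sum, map_add, map_mul]
      refine sum_congr rfl fun i _ => ?_
      have : ∀ t, (σ ^ (n - b)) ((σ ^ b) t) = t := fun t => by
        rw [← AlgEquiv.mul_apply, ← pow_add, Nat.sub_add_cancel hb.le, ← hσ, pow_orderOf_eq_one]
        rfl
      rw [this, this]; ring
    rw [hlow (n - b) (by omega)] at h1
    exact (map_eq_zero _).mp h1
  have hL' : ∀ z, ∑ b ∈ range n, w b * (σ ^ b) z =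
      ∑ b ∈ range (n - 2 * s - 1 + 1), w (s + b) * (σ ^ b) ((σ ^ s) z) := by
    intro z
    have hsub : Ico s (n - s) ⊆ range n := fun b hb => by
      rw [mem_Ico] at hb; rw [mem_range]; omega
    rw [← sum_subset hsub, sum_Ico_eq_sum_range, show n - s - s = n - 2 * s - 1 + 1 by omega]
    · refine sum_congr rfl fun b _ => ?_
      rw [← AlgEquiv.mul_apply, ← pow_add, add_comm s b]
    · intro b hb hb'
      rw [mem_range] at hb
      rw [mem_Ico] at hb'
      rcases le_or_gt s b with h | h
      · rw [hhigh b hb (by omega), zero_mul]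
      · rw [hlow b h.le, zero_mul]
  let τ : K →ₗ[F] (Fin u → F) × (Fin u → F) :=
    (LinearMap.pi fun i => (Algebra.traceForm F K) (x i)).prod
      (LinearMap.pi fun i => (Algebra.traceForm F K) (y i))
  have hτ := LinearMap.finrank_range_add_finrank_ker τ
  have hτr : Module.finrank F (LinearMap.range τ) ≤ u + u := by
    refine (Submodule.finrank_le _).trans ?_
    simp
  have hw0 := coeff_eq_zero_of_lt_finrank σ (mem_range_algebraMap_of_fixed hσ) (n - 2 * s - 1)
    (fun b => w (s + b)) ((LinearMap.ker τ).map ((σ ^ s).toLinearEquiv : K →ₗ[F] K)) (by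
      rintro _ ⟨z, hz, rfl⟩
      have hz : τ z = 0 := hz
      have h1 : ∀ i, Algebra.trace F K (x i * z) = 0 := fun i => congrFun (congrArg Prod.fst hz) i
      have h2 : ∀ i, Algebra.trace F K (y i * z) = 0 := fun i => congrFun (congrArg Prod.snd hz) i
      refine (hL' z).symm.trans ?_
      rw [← hL]
      simp [h1, h2]) (by rw [LinearEquiv.finrank_map_eq]; omega)
  rw [hL, hL']
  refine sum_eq_zero fun b hb => ?_
  have := hw0 b (by rw [mem_range] at hb; omega)
  rw [this, zero_mul]

/-- The map `y ↦ ∑ i, goldPairing (x i) (y i)`. -/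
def goldRelationMap (σ : K ≃ₐ[F] K) (k : ℕ) {u : ℕ} (x : Fin u → K) :
    (Fin u → K) →ₗ[F] (Fin k → K) :=
  ∑ i, goldPairing σ k (x i) ∘ₗ LinearMap.proj i

omit [FiniteDimensional F K] [IsGalois F K] in
theorem goldRelationMap_apply (σ : K ≃ₐ[F] K) (k : ℕ) {u : ℕ} (x y : Fin u → K) :
    goldRelationMap σ k x y = ∑ i, goldPairing σ k (x i) (y i) := by
  simp [goldRelationMap]

theorem finrank_ker_goldRelationMap [CharP K 2] {σ : K ≃ₐ[F] K}
    (hσ : orderOf σ = Module.finrank F K) {s u : ℕ} (hu : u ≤ s) (hs : 2 * s < Module.finrank F K)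
    {x : Fin u → K} (hx : LinearIndependent F x) :
    Module.finrank F (LinearMap.ker (goldRelationMap σ (s + 1) x)) = (u + 1).choose 2 := by
  let Ψ : (Sym2 (Fin u) → F) →ₗ[F] (Fin u → K) :=
    LinearMap.pi fun l => ∑ i, (LinearMap.proj s(l, i) : (Sym2 (Fin u) → F) →ₗ[F] F).smulRight (x i)
  have hΨ : ∀ c l, Ψ c l = ∑ i, c s(l, i) • x i := fun c l => by simp [Ψ]
  have hinj : Function.Injective Ψ := by
    rw [← LinearMap.ker_eq_bot, LinearMap.ker_eq_bot']
    intro c hc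
    ext p
    induction p with
    | _ l i =>
      exact Fintype.linearIndependent_iff.mp hx (fun i => c s(l, i))
        ((hΨ c l).symm.trans (congrFun hc l)) i
  have hrange : LinearMap.range Ψ = LinearMap.ker (goldRelationMap σ (s + 1) x) := by
    apply le_antisymm
    · rintro _ ⟨c, rfl⟩
      rw [LinearMap.mem_ker, goldRelationMap_apply]
      ext j
      rw [Finset.sum_apply]
      simp only [goldPairing_apply, hΨ, map_sum, map_smul, mul_sum, sum_add_distrib, Pi.zero_apply]
      nth_rewrite 2 [sum_comm]
      rw [← sum_add_distrib]
      refine sum_eq_zero fun l _ => ?_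
      rw [← sum_add_distrib]
      refine sum_eq_zero fun i _ => ?_
      rw [Sym2.eq_swap, mul_smul_comm, mul_smul_comm, ← smul_add, mul_comm,
        CharTwo.add_self_eq_zero, smul_zero]
    · intro y hy
      rw [LinearMap.mem_ker, goldRelationMap_apply] at hy
      have hrel := trace_relation_of_sum_goldPairing_eq_zero hσ hu hs x y hy
      obtain ⟨z, hz⟩ := exists_dual_family hx
      have hyl : ∀ l, y l = ∑ i, Algebra.trace F K (y i * z l) • x i := by
        intro l
        have h := hrel (z l)
        rw [sum_add_distrib] at h
        simp only [hz, ite_smul, one_smul, zero_smul, sum_ite_eq', mem_univ, if_true] at h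
        exact (CharTwo.add_eq_zero.mp h).symm
      have hsymm : ∀ l i, Algebra.trace F K (y l * z i) = Algebra.trace F K (y i * z l) := by
        intro l i
        conv_lhs => rw [hyl l]
        simp only [sum_mul, map_sum, smul_mul_assoc, map_smul, hz]
        simp
      refine ⟨Sym2.lift ⟨fun l i => Algebra.trace F K (y l * z i), hsymm⟩, ?_⟩
      ext l
      rw [hΨ, hyl l]
      exact sum_congr rfl fun i _ => by rw [Sym2.lift_mk, hsymm]
  rw [← hrange, LinearMap.finrank_range_of_inj hinj, Module.finrank_fintype_fun_eq_card, Sym2.card,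
    Fintype.card_fin]

theorem finrank_orthogonal_range_goldRelationMap [CharP K 2] {σ : K ≃ₐ[F] K}
    (hσ : orderOf σ = Module.finrank F K) {s u : ℕ} (hu : u ≤ s) (hs : 2 * s < Module.finrank F K)
    {x : Fin u → K} (hx : LinearIndependent F x) :
    Module.finrank F ((traceFormPi F K (s + 1)).orthogonal
        (LinearMap.range (goldRelationMap σ (s + 1) x))) =
      (s + 1 - u) * Module.finrank F K + (u + 1).choose 2 := by
  have h1 := LinearMap.finrank_range_add_finrank_ker (goldRelationMap σ (s + 1) x)
  have h2 := (LinearMap.range (goldRelationMap σ (s + 1) x)).finrank_le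
  rw [finrank_ker_goldRelationMap hσ hu hs hx] at h1
  rw [LinearMap.BilinForm.finrank_orthogonal (traceFormPi_nondegenerate _)]
  rw [Module.finrank_pi_fintype] at h1 h2 ⊢
  simp only [sum_const, card_univ, Fintype.card_fin, smul_eq_mul] at h1 h2 ⊢
  obtain ⟨t, rfl⟩ := Nat.exists_eq_add_of_le hu
  rw [show u + t + 1 - u = t + 1 by omega, show u + t + 1 = u + (t + 1) by ring] at *
  rw [add_mul u] at *
  omega

omit [FiniteDimensional F K] [IsGalois F K] in
theorem mem_orthogonal_range_goldRelationMap (σ : K ≃ₐ[F] K) (k : ℕ) {u : ℕ}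
    (x : Fin u → K) (a : Fin k → K) :
    a ∈ (traceFormPi F K k).orthogonal (LinearMap.range (goldRelationMap σ k x)) ↔
      ∀ i, x i ∈ LinearMap.ker (goldForm σ a) := by
  have hcomm : ∀ a b, traceFormPi F K k a b = traceFormPi F K k b a := fun a b => by
    rw [traceFormPi_apply, traceFormPi_apply]
    exact sum_congr rfl fun j _ => by rw [mul_comm]
  have hsum : ∀ y, traceFormPi F K k (goldRelationMap σ k x y) a =
      ∑ i, goldForm σ a (x i) (y i) := fun y => by
    rw [hcomm, goldRelationMap_apply, map_sum]; rfl
  constructor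
  · intro h i
    rw [LinearMap.mem_ker]
    ext y
    have := h _ ⟨Pi.single i y, rfl⟩
    rw [hsum, sum_eq_single i] at this
    · simpa using this
    · intro l _ hl
      simp [hl]
    · simp
  · rintro h _ ⟨y, rfl⟩
    refine (hsum y).trans ?_
    exact sum_eq_zero fun i _ => by rw [LinearMap.mem_ker.mp (h i)]; rfl

end Gold

section Count

theorem cast_card_linearIndependent {F V : Type*} [Field F] [AddCommGroup V] [Module F V]
    [Fintype F] [Finite V] (u : ℕ) :
    (Nat.card {x : Fin u → V // LinearIndependent F x} : ℚ) =
      ∏ l ∈ range u, ((Fintype.card F : ℚ) ^ Module.finrank F V - (Fintype.card F : ℚ) ^ l) := by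
  rcases le_or_gt u (Module.finrank F V) with h | h
  · rw [card_linearIndependent h, Fin.prod_univ_eq_prod_range
      (fun l => Fintype.card F ^ Module.finrank F V - Fintype.card F ^ l), Nat.cast_prod]
    refine prod_congr rfl fun l hl => ?_
    rw [Nat.cast_sub (Nat.pow_le_pow_right Fintype.card_pos ((mem_range.mp hl).le.trans h))]
    push_cast
    rfl
  · rw [prod_eq_zero (mem_range.mpr h) (sub_self _)]
    have : IsEmpty {x : Fin u → V // LinearIndependent F x} := ⟨fun x => by
      have := x.2.fintype_card_le_finrank
      rw [Fintype.card_fin] at this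
      omega⟩
    simp

theorem cast_card_linearIndependent_mem {F V : Type*} [Field F] [AddCommGroup V] [Module F V]
    [Fintype F] [Fintype V] (W : Submodule F V) (u : ℕ) :
    (#{x : Fin u → V | LinearIndependent F x ∧ ∀ i, x i ∈ W} : ℚ) =
      ∏ l ∈ range u, ((Fintype.card F : ℚ) ^ Module.finrank F W - (Fintype.card F : ℚ) ^ l) := by
  rw [← cast_card_linearIndependent, ← Fintype.card_subtype, ← Nat.card_eq_fintype_card]
  congr 1
  exact Nat.card_congr
    { toFun := fun x => ⟨fun i => ⟨x.1 i, x.2.2 i⟩,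
        LinearIndependent.of_comp W.subtype x.2.1⟩
      invFun := fun x => ⟨fun i => x.1 i, x.2.map' W.subtype W.ker_subtype, fun i => (x.1 i).2⟩
      left_inv := fun _ => rfl
      right_inv := fun _ => rfl }

theorem sum_prod_card_ker_goldForm {F K : Type*} [Field F] [Field K] [Algebra F K] [Fintype F]
    [Fintype K] [CharP K 2] {σ : K ≃ₐ[F] K} (hσ : orderOf σ = Module.finrank F K) {s u : ℕ}
    (hu : u ≤ s) (hs : 2 * s < Module.finrank F K) :
    ∑ a : Fin (s + 1) → K, ∏ l ∈ range u,
        ((Fintype.card F : ℚ) ^ Module.finrank F (LinearMap.ker (goldForm σ a)) -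
          (Fintype.card F : ℚ) ^ l) =
      (∏ l ∈ range u, ((Fintype.card F : ℚ) ^ Module.finrank F K - (Fintype.card F : ℚ) ^ l)) *
        (Fintype.card F : ℚ) ^ ((s + 1 - u) * Module.finrank F K + (u + 1).choose 2) := by
  simp_rw [← cast_card_linearIndependent_mem]
  have hcomm := sum_card_bipartiteAbove_eq_sum_card_bipartiteBelow
    (s := (univ : Finset (Fin (s + 1) → K))) (t := {x : Fin u → K | LinearIndependent F x})
    (fun a x => ∀ i, x i ∈ LinearMap.ker (goldForm σ a))
  have h1 : ∀ x ∈ ({x : Fin u → K | LinearIndependent F x} : Finset (Fin u → K)),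
      #(bipartiteBelow (fun a x => ∀ i, x i ∈ LinearMap.ker (goldForm σ a))
        (univ : Finset (Fin (s + 1) → K)) x) =
      Fintype.card F ^ ((s + 1 - u) * Module.finrank F K + (u + 1).choose 2) := by
    intro x hx
    rw [← finrank_orthogonal_range_goldRelationMap hσ hu hs (mem_filter.mp hx).2,
      ← Module.card_eq_pow_finrank, ← Fintype.card_coe]
    refine Fintype.card_congr (Equiv.subtypeEquivRight fun a => ?_)
    rw [bipartiteBelow, mem_filter, mem_orthogonal_range_goldRelationMap]
    simp
  rw [sum_congr rfl h1, sum_const, smul_eq_mul] at hcomm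
  have h2 : ∏ l ∈ range u, ((Fintype.card F : ℚ) ^ Module.finrank F K - (Fintype.card F : ℚ) ^ l) =
      #{x : Fin u → K | LinearIndependent F x} := by
    rw [← cast_card_linearIndependent, Nat.card_eq_fintype_card, Fintype.card_subtype]
  rw [h2]
  have := congrArg (Nat.cast : ℕ → ℚ) hcomm
  push_cast at this
  rw [← this]
  simp only [bipartiteAbove, filter_filter]

end Count

section GaussBinom

@[simp]
theorem gaussBinom_zero_right {R : Type*} [CommRing R] (q : R) (n : ℕ) : gaussBinom q n 0 = 1 := by
  cases n <;> rfl

theorem gaussBinom_succ_succ {R : Type*} [CommRing R] (q : R) (n i : ℕ) :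
    gaussBinom q (n + 1) (i + 1) = gaussBinom q n i + q ^ (i + 1) * gaussBinom q n (i + 1) := rfl

theorem gaussBinom_eq_zero_of_lt {R : Type*} [CommRing R] (q : R) :
    ∀ {n i : ℕ}, n < i → gaussBinom q n i = 0
  | _, 0, h => absurd h (Nat.not_lt_zero _)
  | 0, _ + 1, _ => rfl
  | n + 1, i + 1, h => by
    rw [gaussBinom_succ_succ, gaussBinom_eq_zero_of_lt q (by omega : n < i),
      gaussBinom_eq_zero_of_lt q (by omega : n < i + 1), mul_zero, add_zero]

theorem prod_pow_sub_pow_succ {R : Type*} [CommRing R] (q : R) (n j : ℕ) :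
    ∏ l ∈ range (j + 1), (q ^ (n + 1) - q ^ l) =
      (q ^ (n + 1) - 1) * q ^ j * ∏ l ∈ range j, (q ^ n - q ^ l) := by
  have h : ∀ l, q ^ (n + 1) - q ^ (l + 1) = q * (q ^ n - q ^ l) := fun l => by ring
  rw [prod_range_succ', prod_congr rfl fun l _ => h l, prod_mul_distrib, prod_const, card_range]
  ring

theorem gaussBinom_mul_prod {R : Type*} [CommRing R] (q : R) (n j : ℕ) :
    gaussBinom q n j * ∏ l ∈ range j, (q ^ j - q ^ l) = ∏ l ∈ range j, (q ^ n - q ^ l) := by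
  induction n generalizing j with
  | zero =>
    cases j with
    | zero => simp
    | succ j =>
      rw [gaussBinom_eq_zero_of_lt q (Nat.succ_pos j), zero_mul,
        prod_eq_zero (mem_range.mpr (Nat.succ_pos j)) (sub_self _)]
  | succ n ih =>
    cases j with
    | zero => simp
    | succ j =>
      have h1 := ih j
      have h2 := (ih (j + 1)).trans (prod_range_succ _ _)
      rw [prod_pow_sub_pow_succ] at h2 ⊢
      rw [prod_pow_sub_pow_succ, gaussBinom_succ_succ]
      linear_combination (q ^ (j + 1) - 1) * q ^ j * h1 + q ^ (j + 1) * h2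

variable {b : ℚ} (hb : 1 < b)
include hb

theorem prod_pow_sub_pow_ne_zero (j : ℕ) : ∏ l ∈ range j, (b ^ j - b ^ l) ≠ 0 :=
  prod_ne_zero_iff.mpr fun _ hl =>
    sub_ne_zero.mpr (pow_lt_pow_right₀ hb (mem_range.mp hl)).ne'

theorem gaussBinom_mul_gaussBinom (i r t : ℕ) :
    gaussBinom b (i + t) i * gaussBinom b (i + r) (i + t) =
      gaussBinom b (i + r) i * gaussBinom b r t := by
  have hprod : ∀ r, ∏ l ∈ range (i + t), (b ^ (i + r) - b ^ l) =
      (∏ l ∈ range i, (b ^ (i + r) - b ^ l)) * (b ^ (i * t) * ∏ l ∈ range t, (b ^ r - b ^ l)) := by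
    intro r
    have h : ∀ l, b ^ (i + r) - b ^ (i + l) = b ^ i * (b ^ r - b ^ l) := fun l => by ring
    rw [prod_range_add, prod_congr rfl fun l _ => h l, prod_mul_distrib (f := fun _ => b ^ i),
      prod_const, card_range, ← pow_mul]
  have h1 := gaussBinom_mul_prod b (i + r) (i + t)
  have h2 := gaussBinom_mul_prod b (i + t) i
  have h3 := gaussBinom_mul_prod b (i + r) i
  have h4 := gaussBinom_mul_prod b r t
  rw [hprod, hprod, ← h2, ← h3, ← h4] at h1
  have hi := prod_pow_sub_pow_ne_zero hb i
  have ht := prod_pow_sub_pow_ne_zero hb t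
  have hp : b ^ (i * t) ≠ 0 := pow_ne_zero _ (by linarith)
  have hne := mul_ne_zero (mul_ne_zero hi ht) hp
  apply mul_right_cancel₀ hne
  linear_combination h1

omit hb in
theorem sum_alternating_gaussBinom (r n : ℕ) (h : r < n) :
    ∑ t ∈ range n, (-1 : ℚ) ^ t * b ^ t.choose 2 * gaussBinom b r t = if r = 0 then 1 else 0 := by
  obtain ⟨n, rfl⟩ := Nat.exists_eq_add_of_lt (Nat.zero_lt_of_lt h)
  rw [zero_add] at *
  cases r with
  | zero =>
    rw [sum_range_succ']
    simp [gaussBinom]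
  | succ r =>
    have key : ∀ n, ∑ t ∈ range (n + 1), (-1 : ℚ) ^ t * b ^ t.choose 2 * gaussBinom b (r + 1) t =
        (-1) ^ n * b ^ (n + 1).choose 2 * gaussBinom b r n := by
      intro n
      induction n with
      | zero => simp
      | succ n ih =>
        rw [sum_range_succ, ih, gaussBinom_succ_succ, Nat.choose_succ_succ (n + 1) 1,
          Nat.choose_one_right]
        ring
    rw [key, gaussBinom_eq_zero_of_lt b (by omega : r < n)]
    simp

/-- Inversion for Gaussian binomial coefficients. -/
theorem sum_gaussBinom_inversion {i M s : ℕ} (hM : M ≤ s) (hi : i ≤ s) :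
    ∑ j ∈ Icc i s, (-1 : ℚ) ^ (j - i) * b ^ (j - i).choose 2 * gaussBinom b j i *
      gaussBinom b M j = if M = i then 1 else 0 := by
  rcases lt_or_ge M i with h | h
  · rw [if_neg h.ne]
    refine sum_eq_zero fun j hj => ?_
    rw [gaussBinom_eq_zero_of_lt b (h.trans_le (mem_Icc.mp hj).1), mul_zero]
  · obtain ⟨r, rfl⟩ := Nat.exists_eq_add_of_le h
    have hIcc : Icc i s = Ico i (s + 1) := by ext; simp
    rw [hIcc, sum_Ico_eq_sum_range]
    have hterm : ∀ t, (-1 : ℚ) ^ (i + t - i) * b ^ (i + t - i).choose 2 * gaussBinom b (i + t) i *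
        gaussBinom b (i + r) (i + t) =
        gaussBinom b (i + r) i * ((-1 : ℚ) ^ t * b ^ t.choose 2 * gaussBinom b r t) := by
      intro t
      rw [mul_assoc, gaussBinom_mul_gaussBinom hb, Nat.add_sub_cancel_left]
      ring
    rw [sum_congr rfl fun t _ => hterm t, ← mul_sum, sum_alternating_gaussBinom r _ (by omega)]
    rcases Nat.eq_zero_or_pos r with rfl | hr
    · have hii : gaussBinom b i i = 1 := mul_right_cancel₀ (prod_pow_sub_pow_ne_zero hb i)
        ((gaussBinom_mul_prod b i i).trans (one_mul _).symm)
      simp [hii]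
    · rw [if_neg hr.ne', if_neg (by omega), mul_zero]

end GaussBinom

/-- If the moments of `X` in the basis `∏ (X - q ^ l)` are those of an alternating form design,
then so are the moments in the basis `∏ (X - q ^ (2 * l + 1))`. -/
theorem sum_prod_sub_odd_pow {ι : Type*} [Fintype ι] (X : ι → ℚ) (q Q T : ℚ) (s : ℕ)
    (hX : ∀ u ≤ s, ∑ a, ∏ l ∈ range u, (X a - q ^ l) =
      T * ((∏ l ∈ range u, (1 - q ^ l / Q)) * q ^ (u + 1).choose 2)) {j : ℕ} (hj : j ≤ s) :
    ∑ a, ∏ l ∈ range j, (X a - q ^ (2 * l + 1)) = T * ∏ l ∈ range j, (1 - q ^ (2 * l + 1) / Q) := by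
  set g : ℕ → ι → ℚ := fun u a => ∏ l ∈ range u, (X a - q ^ l) with hg
  set h : ℕ → ℚ := fun u => (∏ l ∈ range u, (1 - q ^ l / Q)) * q ^ (u + 1).choose 2 with hh
  have hgs : ∀ u a, g (u + 1) a = g u a * (X a - q ^ u) := fun u a => prod_range_succ _ _
  have hhs : ∀ u, h (u + 1) = h u * (1 - q ^ u / Q) * q ^ (u + 1) := fun u => by
    simp only [hh]
    rw [prod_range_succ, Nat.choose_succ_succ (u + 1) 1, Nat.choose_one_right]
    ring
  have key : ∀ j u, u + j ≤ s →
      (∑ a, g u a * ∏ l ∈ range j, (X a - q ^ (u + 2 * l + 1)) =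
        T * h u * q ^ (u * j) * ∏ l ∈ range j, (1 - q ^ (u + 2 * l + 1) / Q)) ∧
      (∑ a, g u a * ∏ l ∈ range j, (X a - q ^ (u + 2 * l)) =
        T * h u * q ^ (u * j) * q ^ j * ∏ l ∈ range j, (1 - q ^ (u + 2 * l) / Q)) := by
    intro j
    induction j with
    | zero =>
      intro u hu
      simp [hg, hX u hu, hh]
    | succ j ih =>
      intro u hu
      have h1 := (ih u (by omega)).1
      have h2 := (ih (u + 1) (by omega)).1
      have h3 := (ih (u + 1) (by omega)).2
      have hodd : ∀ l, u + 1 + 2 * l + 1 = u + 2 * (l + 1) := fun l => by ring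
      have heven : ∀ l, u + 1 + 2 * l = u + 2 * l + 1 := fun l => by ring
      simp only [hodd] at h2
      simp only [heven] at h3
      constructor
      · have hsplit : ∀ a, g u a * ∏ l ∈ range (j + 1), (X a - q ^ (u + 2 * l + 1)) =
            g (u + 1) a * ∏ l ∈ range j, (X a - q ^ (u + 2 * l + 1)) -
            (q ^ (u + 2 * j + 1) - q ^ u) *
              (g u a * ∏ l ∈ range j, (X a - q ^ (u + 2 * l + 1))) := fun a => by
          rw [prod_range_succ, hgs]; ring
        rw [sum_congr rfl fun a _ => hsplit a, sum_sub_distrib, ← mul_sum, h1, h3, hhs,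
          prod_range_succ]
        ring
      · have hsplit : ∀ a, g u a * ∏ l ∈ range (j + 1), (X a - q ^ (u + 2 * l)) =
            g (u + 1) a * ∏ l ∈ range j, (X a - q ^ (u + 2 * (l + 1))) := fun a => by
          rw [prod_range_succ', hgs]; ring
        rw [sum_congr rfl fun a _ => hsplit a, h2, hhs, prod_range_succ']
        ring
  have := (key j 0 (by omega)).1
  simpa [hg, hh] using this

section Gold

variable {F K : Type*} [Field F] [Field K] [Algebra F K] [Fintype F] [Fintype K] [CharP K 2]
  {σ : K ≃ₐ[F] K} (hσ : orderOf σ = Module.finrank F K)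
include hσ

theorem sum_gaussBinom_goldForm {s N : ℕ} (hN : Module.finrank F K = 2 * N + 1) (hs : s ≤ N)
    (M : (Fin (s + 1) → K) → ℕ)
    (hM : ∀ a, Module.finrank F (LinearMap.ker (goldForm σ a)) = 2 * M a + 1) {j : ℕ}
    (hj : j ≤ s) :
    ∑ a, gaussBinom ((Fintype.card F : ℚ) ^ 2) (M a) j =
      (Fintype.card K : ℚ) ^ (s + 1 - j) * gaussBinom ((Fintype.card F : ℚ) ^ 2) N j := by
  set q : ℚ := (Fintype.card F : ℚ) with hq
  have hq1 : 1 < q := by rw [hq]; exact_mod_cast Fintype.one_lt_card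
  have hq0 : q ≠ 0 := by positivity
  have hQ : (Fintype.card K : ℚ) = q ^ (2 * N + 1) := by
    rw [Module.card_eq_pow_finrank (K := F) (V := K), hN]; push_cast; rfl
  have hb : 1 < q ^ 2 := one_lt_pow₀ hq1 two_ne_zero
  have hfactor : ∀ n, ∏ l ∈ range j, (q ^ (2 * n + 1) - q ^ (2 * l + 1)) =
      q ^ j * ∏ l ∈ range j, ((q ^ 2) ^ n - (q ^ 2) ^ l) := by
    intro n
    have h : ∀ l, q ^ (2 * n + 1) - q ^ (2 * l + 1) = q * ((q ^ 2) ^ n - (q ^ 2) ^ l) :=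
      fun l => by ring
    rw [prod_congr rfl fun l _ => h l, prod_mul_distrib (f := fun _ => q), prod_const, card_range]
  have hdiv : ∀ (c : ℕ → ℕ) (u : ℕ), ∏ l ∈ range u, (q ^ (2 * N + 1) - q ^ c l) =
      (q ^ (2 * N + 1)) ^ u * ∏ l ∈ range u, (1 - q ^ c l / q ^ (2 * N + 1)) := by
    intro c u
    have h : ∀ l, q ^ (2 * N + 1) - q ^ c l =
        q ^ (2 * N + 1) * (1 - q ^ c l / q ^ (2 * N + 1)) := fun l => by field_simp
    rw [prod_congr rfl fun l _ => h l, prod_mul_distrib (f := fun _ => q ^ (2 * N + 1)),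
      prod_const, card_range]
  have hmom := sum_prod_sub_odd_pow (fun a => q ^ (2 * M a + 1)) q (q ^ (2 * N + 1))
    ((q ^ (2 * N + 1)) ^ (s + 1)) s (fun u hu => by
      have := sum_prod_card_ker_goldForm hσ hu (by omega)
      simp only [hM, hN, ← hq] at this
      rw [this, hdiv, pow_add, mul_comm (s + 1 - u), pow_mul,
        ← Nat.sub_add_cancel (show u ≤ s + 1 by omega), Nat.add_sub_cancel, pow_add _ _ u]
      ring) hj
  simp only [hfactor] at hmom
  apply mul_right_cancel₀ (mul_ne_zero (pow_ne_zero j hq0) (prod_pow_sub_pow_ne_zero hb j))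
  rw [sum_mul, hQ]
  have hsum : ∀ n, gaussBinom (q ^ 2) n j * (q ^ j * ∏ l ∈ range j, ((q ^ 2) ^ j - (q ^ 2) ^ l)) =
      q ^ j * ∏ l ∈ range j, ((q ^ 2) ^ n - (q ^ 2) ^ l) := fun n => by
    rw [← gaussBinom_mul_prod (q ^ 2) n j]; ring
  rw [mul_assoc, hsum, sum_congr rfl fun a _ => hsum (M a), hmom, ← hfactor, hdiv, ← mul_assoc,
    ← pow_add, Nat.sub_add_cancel (by omega)]

omit hσ [CharP K 2] in
theorem card_tail_eq_zero (s : ℕ) :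
    #{a : Fin (s + 1) → K | ¬ ∃ j : Fin (s + 1), (j : ℕ) ≠ 0 ∧ a j ≠ 0} = Fintype.card K := by
  rw [← card_univ, eq_comm]
  refine card_bij' (fun c _ => Fin.cons c 0) (fun a _ => a 0) ?_ (fun _ _ => mem_univ _)
    (fun _ _ => rfl) ?_
  · intro c _
    simp only [mem_filter, mem_univ, true_and, not_exists, not_and, not_not]
    intro j hj
    induction j using Fin.cases with
    | zero => exact absurd rfl hj
    | succ i => rfl
  · intro a ha
    simp only [mem_filter, mem_univ, true_and, not_exists, not_and, not_not] at ha
    ext j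
    refine Fin.cases rfl (fun i => ?_) j
    rw [ha i.succ (by simp)]
    rfl

theorem card_goldForm_eq {s N : ℕ} (hN : Module.finrank F K = 2 * N + 1) (hs : s + 1 ≤ N)
    {i : ℕ} (hi : i ≤ s) :
    (#{a : Fin (s + 1 + 1) → K | Module.finrank F (LinearMap.ker (goldForm σ a)) = 2 * i + 1 ∧
        ∃ j : Fin (s + 1 + 1), (j : ℕ) ≠ 0 ∧ a j ≠ 0} : ℚ) / Fintype.card K =
      ∑ j ∈ Icc i s, (-1 : ℚ) ^ (j - i) * ((Fintype.card F : ℚ) ^ 2) ^ (j - i).choose 2 *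
        gaussBinom ((Fintype.card F : ℚ) ^ 2) j i * gaussBinom ((Fintype.card F : ℚ) ^ 2) N j *
          ((Fintype.card K : ℚ) ^ (s + 1 - j) - 1) := by
  have hodd : ∀ a : Fin (s + 1 + 1) → K,
      ∃ M, Module.finrank F (LinearMap.ker (goldForm σ a)) = 2 * M + 1 := fun a => by
    have h := even_finrank_add_finrank_radical (goldForm σ a) (goldForm_isAlt σ a)
    rw [hN, Nat.even_add] at h
    exact Nat.not_even_iff_odd.mp fun h' => by
      have := h.mpr h'
      rw [Nat.even_add_one] at this
      exact this (even_two_mul N)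
  choose M hM using hodd
  have hle : ∀ a, (∃ j : Fin (s + 1 + 1), (j : ℕ) ≠ 0 ∧ a j ≠ 0) → M a ≤ s := fun a ha => by
    have := finrank_ker_goldForm_le hσ (s + 1) a ha
    rw [hM] at this
    omega
  have hzero : ∀ a, (¬ ∃ j : Fin (s + 1 + 1), (j : ℕ) ≠ 0 ∧ a j ≠ 0) → M a = N := fun a ha => by
    have htop : goldForm σ a = 0 := by
      ext x y
      rw [goldForm_apply, traceFormPi_apply]
      refine sum_eq_zero fun j _ => ?_
      by_cases hj : (j : ℕ) = 0
      · simp [goldPairing_apply, hj, CharTwo.add_self_eq_zero]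
      · have : a j = 0 := by by_contra h; exact ha ⟨j, hj, h⟩
        rw [this, zero_mul, map_zero]
    have := hM a
    rw [htop, LinearMap.ker_zero, finrank_top, hN] at this
    omega
  set b : ℚ := (Fintype.card F : ℚ) ^ 2 with hb
  have hb1 : 1 < b := one_lt_pow₀ (by exact_mod_cast Fintype.one_lt_card) two_ne_zero
  have hK0 : (Fintype.card K : ℚ) ≠ 0 := by exact_mod_cast Fintype.card_ne_zero
  set P : (Fin (s + 1 + 1) → K) → Prop := fun a => ∃ j : Fin (s + 1 + 1), (j : ℕ) ≠ 0 ∧ a j ≠ 0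
  have hnz : ∀ j ≤ s, ∑ a with P a, gaussBinom b (M a) j =
      Fintype.card K * (gaussBinom b N j * ((Fintype.card K : ℚ) ^ (s + 1 - j) - 1)) := by
    intro j hj
    have h1 := sum_gaussBinom_goldForm hσ hN hs M hM (show j ≤ s + 1 by omega)
    rw [← sum_filter_add_sum_filter_not univ P, ← hb] at h1
    have h2 : ∑ a with ¬ P a, gaussBinom b (M a) j = Fintype.card K * gaussBinom b N j := by
      rw [sum_congr rfl fun a ha => by rw [hzero a (mem_filter.mp ha).2], sum_const,
        card_tail_eq_zero, nsmul_eq_mul]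
    rw [h2, show s + 1 + 1 - j = s + 1 - j + 1 by omega, pow_succ] at h1
    linear_combination h1
  rw [div_eq_iff hK0]
  have hcard : (#{a : Fin (s + 1 + 1) → K |
      Module.finrank F (LinearMap.ker (goldForm σ a)) = 2 * i + 1 ∧ P a} : ℚ) =
      ∑ a with P a, if M a = i then (1 : ℚ) else 0 := by
    rw [sum_boole, filter_filter]
    congr 2
    ext a
    simp only [mem_filter, mem_univ, true_and, hM]
    constructor
    · rintro ⟨h, h'⟩; exact ⟨h', by omega⟩
    · rintro ⟨h, h'⟩; exact ⟨by omega, h⟩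
  rw [hcard, sum_congr rfl fun a ha =>
    (sum_gaussBinom_inversion hb1 (hle a (mem_filter.mp ha).2) hi).symm, sum_comm, sum_mul]
  refine sum_congr rfl fun j hj => ?_
  rw [← mul_sum, hnz j (mem_Icc.mp hj).2]
  ring

end Gold

theorem exists_frobenius_pow {F K : Type*} [Field F] [Field K] [Algebra F K] [Fintype F] [Fintype K]
    (r : ℕ) (hr : (Module.finrank F K).Coprime r) :
    ∃ σ : K ≃ₐ[F] K, orderOf σ = Module.finrank F K ∧
      ∀ (j : ℕ) (x : K), (σ ^ j) x = x ^ Fintype.card F ^ (r * j) := by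
  refine ⟨FiniteField.frobeniusAlgEquivOfAlgebraic F K ^ r, ?_, fun j x => ?_⟩
  · rw [Nat.Coprime.orderOf_pow, FiniteField.orderOf_frobeniusAlgEquivOfAlgebraic]
    rwa [FiniteField.orderOf_frobeniusAlgEquivOfAlgebraic]
  · rw [← pow_mul, AlgEquiv.coe_pow, FiniteField.coe_frobeniusAlgEquivOfAlgebraic_iterate]

/-- The rank distribution of the Gold type bilinear forms: for `0 ≤ i ≤ k-2`,
`β_{(m-e)/e - 2i} = Σ_{j=i}^{k-2} (-1)^{j-i} 2^{e(j-i)(j-i-1)} (j choose i)_{4^e}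
((m-e)/(2e) choose j)_{4^e} (2^{m(k-1-j)} - 1)`, where
`β_r = 2^{-m}·#{a⃗ : rk(B_{a⃗}) = r, (a_1,…,a_{k-1}) ≠ 0}`. -/
theorem gold_rank_distribution (m d e k : ℕ)
    (hm : 0 < m) (hd : 0 < d) (he : 0 < e)
    (he1 : e = Nat.gcd m d) (he2 : e = Nat.gcd m (2 * d))
    (hk1 : 2 ≤ k) (hk2 : k ≤ (m + e) / (2 * e))
    (F K : Type*) [Field F] [Field K] [Algebra F K] [Fintype F] [Fintype K]
    (hF : Fintype.card F = 2 ^ e) (hK : Fintype.card K = 2 ^ m)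
    (rk : (Fin k → K) → ℕ)
    (hrk : ∀ (a : Fin k → K) (W : Submodule F K),
      (W : Set K) = {x : K | ∀ y : K,
        ∑ j ∈ Finset.univ.filter (fun j : Fin k => (j : ℕ) ≠ 0),
          Algebra.trace F K (a j * (x * y ^ (2 ^ ((j : ℕ) * d)) +
            x ^ (2 ^ ((j : ℕ) * d)) * y)) = 0} →
      rk a = m / e - Module.finrank F W)
    (i : ℕ) (hi : i ≤ k - 2) :
    ((Finset.univ.filter (fun a : Fin k → K =>
        rk a = (m - e) / e - 2 * i ∧ ∃ j : Fin k, (j : ℕ) ≠ 0 ∧ a j ≠ 0)).card : ℚ) /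
          2 ^ m =
      ∑ j ∈ Finset.Icc i (k - 2),
        (-1 : ℚ) ^ (j - i) * 2 ^ (e * (j - i) * (j - i - 1)) *
          gaussBinom ((4 : ℚ) ^ e) j i * gaussBinom ((4 : ℚ) ^ e) ((m - e) / (2 * e)) j *
          (2 ^ (m * (k - 1 - j)) - 1) := by
  have hchar : CharP K 2 := by
    have : Fact (Nat.Prime 2) := ⟨Nat.prime_two⟩
    exact charP_of_card_eq_prime_pow hK
  set n := Module.finrank F K with hn
  have hmn : m = e * n := by
    have h := Module.card_eq_pow_finrank (K := F) (V := K)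
    rw [hF, hK, ← pow_mul] at h
    exact Nat.pow_right_injective le_rfl h
  obtain ⟨r, hr⟩ : e ∣ d := he1 ▸ Nat.gcd_dvd_right m d
  have hcop : n.Coprime (2 * r) := by
    have h : e * 1 = e * n.gcd (2 * r) := by
      rw [← Nat.gcd_mul_left, ← hmn, mul_left_comm, ← hr, ← he2, mul_one]
    exact (Nat.eq_of_mul_eq_mul_left he h).symm
  obtain ⟨N, hN⟩ : Odd n := Nat.coprime_two_right.mp hcop.coprime_mul_right_right
  obtain ⟨σ, hσ, hσx⟩ := exists_frobenius_pow (F := F) (K := K) r hcop.coprime_mul_left_right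
  have hdiv1 : m / e = 2 * N + 1 := by rw [hmn, Nat.mul_div_cancel_left _ he, hN]
  have hdiv2 : (m - e) / e = 2 * N := by
    rw [show m - e = e * (2 * N) by rw [hmn, hN, mul_add, mul_one, Nat.add_sub_cancel],
      Nat.mul_div_cancel_left _ he]
  have hdiv3 : (m - e) / (2 * e) = N := by rw [mul_comm, ← Nat.div_div_eq_div_mul, hdiv2]; omega
  have hdiv4 : (m + e) / (2 * e) = N + 1 := by
    rw [show m + e = 2 * e * (N + 1) by rw [hmn, hN]; ring, Nat.mul_div_cancel_left _ (by omega)]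
  obtain ⟨s, rfl⟩ : ∃ s, k = s + 1 + 1 := ⟨k - 2, by omega⟩
  have hrk' : ∀ a, rk a = 2 * N + 1 - Module.finrank F (LinearMap.ker (goldForm σ a)) := by
    intro a
    rw [hrk a (LinearMap.ker (goldForm σ a)), hdiv1]
    ext x
    rw [SetLike.mem_coe, LinearMap.mem_ker, LinearMap.ext_iff, Set.mem_ofPred_eq]
    refine forall_congr' fun y => ?_
    rw [LinearMap.zero_apply, goldForm_apply, traceFormPi_apply, sum_filter_of_ne]
    · simp only [goldPairing_apply, hσx, hF, ← pow_mul, hr, mul_left_comm, mul_comm]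
    · intro j _ hj h0
      simp [h0, CharTwo.add_self_eq_zero] at hj
  have hcard : (#{a : Fin (s + 1 + 1) → K | rk a = (m - e) / e - 2 * i ∧
      ∃ j : Fin (s + 1 + 1), (j : ℕ) ≠ 0 ∧ a j ≠ 0} : ℚ) =
      #{a : Fin (s + 1 + 1) → K | Module.finrank F (LinearMap.ker (goldForm σ a)) = 2 * i + 1 ∧
        ∃ j : Fin (s + 1 + 1), (j : ℕ) ≠ 0 ∧ a j ≠ 0} := by
    congr 2
    ext a
    rw [mem_filter, mem_filter, hrk', hdiv2]
    have := (LinearMap.ker (goldForm σ a)).finrank_le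
    refine and_congr_right fun _ => and_congr_left fun _ => ?_
    omega
  have hKQ : (Fintype.card K : ℚ) = 2 ^ m := by rw [hK]; push_cast; rfl
  have hFQ : (Fintype.card F : ℚ) ^ 2 = 4 ^ e := by
    rw [hF]; push_cast; rw [← pow_mul, mul_comm, pow_mul]; norm_num
  have main := card_goldForm_eq hσ hN (by omega) (show i ≤ s by omega)
  rw [hKQ, hFQ] at main
  rw [hcard, main, hdiv3]
  refine sum_congr rfl fun j _ => ?_
  have hpow : ((4 : ℚ) ^ e) ^ (j - i).choose 2 = 2 ^ (e * (j - i) * (j - i - 1)) := by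
    rw [show (4 : ℚ) = 2 ^ 2 by norm_num, ← pow_mul, ← pow_mul, Nat.choose_two_right]
    congr 1
    have := Nat.div_mul_cancel (Nat.even_mul_pred_self (j - i)).two_dvd
    linear_combination e * this
  rw [hpow, ← pow_mul, show s + 1 + 1 - 1 - j = s + 1 - j by omega]
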